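/- arXiv:2107.01685 — 5 statements merged into one kernel-verified Lean document; each statement's English description precedes it below -/
import Mathlib

section
/- Let (M,d) be a complete metric space, and let A, B be nonempty closed subsets of M such that A₀ = {x ∈ A : ∃ y ∈ B, d(x,y) = dist(A,B)} is nonempty and B is approximatively compact with respect to A. Let T : A → B be a p-proximal contraction with contraction constant k satisfying 0 < k < 1/3, and suppose T(A₀) ⊆ B₀ where B₀ = {y ∈ B : ∃ x ∈ A, d(x,y) = dist(A,B)}. Then T has a unique best proximity point, i.e., there exists a unique z ∈ A with d(z, T z) = dist(A,B). -/
open Metric Filter Topology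

/-- The distance between two sets: `inf {d(x,y) : x ∈ A, y ∈ B}`. -/
noncomputable def SetDist {M : Type*} [MetricSpace M] (A B : Set M) : ℝ :=
  sInf {r : ℝ | ∃ x ∈ A, ∃ y ∈ B, r = dist x y}

/-- `A₀ = {x ∈ A : ∃ y ∈ B, d(x,y) = dist(A,B)}`. -/
def SetA0 {M : Type*} [MetricSpace M] (A B : Set M) : Set M :=
  {x ∈ A | ∃ y ∈ B, dist x y = SetDist A B}

/-- `B₀ = {y ∈ B : ∃ x ∈ A, d(x,y) = dist(A,B)}`. -/
def SetB0 {M : Type*} [MetricSpace M] (A B : Set M) : Set M :=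
  {y ∈ B | ∃ x ∈ A, dist x y = SetDist A B}

/-- `T : A → B` is a p-proximal contraction with constant `k`. -/
def IsPProximalContraction {M : Type*} [MetricSpace M] (A B : Set M) (T : M → M) (k : ℝ) : Prop :=
  (∀ x ∈ A, T x ∈ B) ∧
  ∀ u₁ ∈ A, ∀ u₂ ∈ A, ∀ x₁ ∈ A, ∀ x₂ ∈ A,
    dist u₁ (T x₁) = SetDist A B → dist u₂ (T x₂) = SetDist A B →
    dist u₁ u₂ ≤ k * (dist x₁ x₂ + |dist u₁ x₁ - dist u₂ x₂|)

/-- `B` is approximatively compact with respect to `A`: every sequence in `B` with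
`d(x, yₙ) → dist(x, B)` for some `x ∈ A` has a convergent subsequence. -/
def ApproxCompactWRT {M : Type*} [MetricSpace M] (A B : Set M) : Prop :=
  ∀ y : ℕ → M, (∀ n, y n ∈ B) →
    (∃ x ∈ A, Tendsto (fun n => dist x (y n)) atTop (𝓝 (Metric.infDist x B))) →
    ∃ φ : ℕ → ℕ, StrictMono φ ∧ ∃ l : M, Tendsto (y ∘ φ) atTop (𝓝 l)

theorem bddBelow_setOf_dist {M : Type*} [MetricSpace M] (A B : Set M) :
    BddBelow {r : ℝ | ∃ x ∈ A, ∃ y ∈ B, r = dist x y} :=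
  ⟨0, by rintro r ⟨x, -, y, -, rfl⟩; exact dist_nonneg⟩

theorem setDist_le_dist {M : Type*} [MetricSpace M] {A B : Set M} {x y : M}
    (hx : x ∈ A) (hy : y ∈ B) : SetDist A B ≤ dist x y :=
  csInf_le (bddBelow_setOf_dist A B) ⟨x, hx, y, hy, rfl⟩

/-- If `A` is closed and `B` is closed and approximatively compact with respect to `A`, a limit of
points of `A` that are at distance `SetDist A B` from points of `B` lies in `SetA0 A B`. -/
theorem mem_setA0_of_tendsto {M : Type*} [MetricSpace M] {A B : Set M}
    (hAcl : IsClosed A) (hBcl : IsClosed B) (hcomp : ApproxCompactWRT A B)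
    {x y : ℕ → M} {z : M} (hx : ∀ n, x n ∈ A) (hy : ∀ n, y n ∈ B)
    (hxy : ∀ n, dist (x n) (y n) = SetDist A B) (hz : Tendsto x atTop (𝓝 z)) :
    z ∈ SetA0 A B := by
  have hzA : z ∈ A := hAcl.mem_of_tendsto hz (Eventually.of_forall hx)
  have hlim : Tendsto (fun n => dist z (y n)) atTop (𝓝 (SetDist A B)) := by
    have hupper : Tendsto (fun n => dist z (x n) + SetDist A B) atTop (𝓝 (SetDist A B)) := by
      simpa using (tendsto_const_nhds.dist hz : Tendsto (fun n => dist z (x n)) atTop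
        (𝓝 (dist z z))).add_const (SetDist A B)
    refine tendsto_of_tendsto_of_tendsto_of_le_of_le tendsto_const_nhds hupper
      (fun n => setDist_le_dist hzA (hy n)) fun n => ?_
    calc dist z (y n) ≤ dist z (x n) + dist (x n) (y n) := dist_triangle _ _ _
      _ = dist z (x n) + SetDist A B := by rw [hxy]
  have hinf : infDist z B = SetDist A B :=
    le_antisymm (ge_of_tendsto' hlim fun n => infDist_le_dist_of_mem (hy n))
      ((le_infDist ⟨y 0, hy 0⟩).2 fun _ hb => setDist_le_dist hzA hb)
  obtain ⟨φ, hφ, l, hl⟩ := hcomp y hy ⟨z, hzA, hinf ▸ hlim⟩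
  exact ⟨hzA, l, hBcl.mem_of_tendsto hl (Eventually.of_forall fun n => hy (φ n)),
    tendsto_nhds_unique (tendsto_const_nhds.dist hl) (hlim.comp hφ.tendsto_atTop)⟩

theorem le_mul_of_le_mul_add_abs_sub {a b k : ℝ} (ha : 0 ≤ a) (hk0 : 0 < k) (hk : k < 1)
    (h : b ≤ k * (a + |a - b|)) : b ≤ 2 * k / (1 + k) * a := by
  rw [div_mul_eq_mul_div, le_div_iff₀ (by linarith)]
  rcases abs_cases (a - b) with ⟨hab, _⟩ | ⟨hab, _⟩ <;> rw [hab] at h <;> nlinarith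

theorem best_proximity_point_of_pProximal_lt_third
    {M : Type*} [MetricSpace M] [CompleteSpace M]
    (A B : Set M) (hA : A.Nonempty) (hB : B.Nonempty)
    (hAcl : IsClosed A) (hBcl : IsClosed B)
    (hA0 : (SetA0 A B).Nonempty)
    (hcomp : ApproxCompactWRT A B)
    (T : M → M) (k : ℝ) (hk0 : 0 < k) (hk : k < 1 / 3)
    (hT : IsPProximalContraction A B T k)
    (hTA0 : ∀ x ∈ SetA0 A B, T x ∈ SetB0 A B) :
    ∃! z, z ∈ A ∧ dist z (T z) = SetDist A B := by
  obtain ⟨hTB, hT⟩ := hT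
  have hk1 : k < 1 := by linarith
  have hstep : ∀ x : SetA0 A B, ∃ u : SetA0 A B, dist (u : M) (T x) = SetDist A B := by
    rintro ⟨x, hx⟩
    obtain ⟨hB, u, hu, hd⟩ := hTA0 x hx
    exact ⟨⟨u, hu, T x, hB, hd⟩, hd⟩
  choose f hf using hstep
  obtain ⟨x₀, hx₀⟩ := hA0
  let x : ℕ → M := fun n => (f^[n] ⟨x₀, hx₀⟩ : SetA0 A B)
  have hxA : ∀ n, x n ∈ A := fun n => (f^[n] ⟨x₀, hx₀⟩ : SetA0 A B).2.1
  have hxT : ∀ n, dist (x (n + 1)) (T (x n)) = SetDist A B := fun n => by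
    simp only [x, Function.iterate_succ_apply']
    exact hf _
  have hratio : ∀ n, dist (x (n + 1)) (x (n + 2)) ≤
      2 * k / (1 + k) * dist (x n) (x (n + 1)) := fun n => by
    have h := hT _ (hxA (n + 1)) _ (hxA (n + 2)) _ (hxA n) _ (hxA (n + 1)) (hxT n) (hxT (n + 1))
    rw [dist_comm (x (n + 1)) (x n), dist_comm (x (n + 2)) (x (n + 1))] at h
    exact le_mul_of_le_mul_add_abs_sub dist_nonneg hk0 hk1 h
  have hgeom : ∀ n, dist (x n) (x (n + 1)) ≤ dist (x 0) (x 1) * (2 * k / (1 + k)) ^ n := by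
    intro n
    induction n with
    | zero => simp
    | succ n ih =>
      calc _ ≤ 2 * k / (1 + k) * dist (x n) (x (n + 1)) := hratio n
        _ ≤ 2 * k / (1 + k) * (dist (x 0) (x 1) * (2 * k / (1 + k)) ^ n) := by gcongr
        _ = _ := by ring
  have hr : 2 * k / (1 + k) < 1 := by
    rw [div_lt_one (by linarith)]
    linarith
  obtain ⟨z, hz⟩ := cauchySeq_tendsto_of_complete (cauchySeq_of_le_geometric _ _ hr hgeom)
  have hz' : Tendsto (fun n => x (n + 1)) atTop (𝓝 z) := hz.comp (tendsto_add_atTop_nat 1)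
  have hzA0 : z ∈ SetA0 A B := mem_setA0_of_tendsto hAcl hBcl hcomp (fun n => hxA (n + 1))
    (fun n => hTB _ (hxA n)) hxT hz'
  obtain ⟨-, u, huA, hu⟩ := hTA0 z hzA0
  have hle : dist z u ≤ k * (dist z z + |dist z z - dist u z|) :=
    le_of_tendsto_of_tendsto' (hz'.dist tendsto_const_nhds)
      (((hz.dist tendsto_const_nhds).add
        ((hz'.dist hz).sub tendsto_const_nhds).abs).const_mul k)
      fun n => hT _ (hxA (n + 1)) _ huA _ (hxA n) _ hzA0.1 (hxT n) hu
  have hzu : z = u := by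
    rw [dist_self, zero_sub, zero_add, abs_neg, abs_of_nonneg dist_nonneg, dist_comm u z] at hle
    exact dist_le_zero.1 (by nlinarith)
  refine ⟨z, ⟨hzA0.1, by rwa [← hzu] at hu⟩, ?_⟩
  rintro w ⟨hwA, hw⟩
  have h := hT w hwA z hzA0.1 w hwA z hzA0.1 hw (by rwa [← hzu] at hu)
  rw [dist_self, dist_self, sub_zero, abs_zero, add_zero] at h
  exact dist_le_zero.1 (by nlinarith)
end

section
/- Let (X,d) be a metric space and let A, B be nonempty closed subsets of X such that B is approximatively compact with respect to A. Then the set A₀ = {x ∈ A : ∃ y ∈ B, d(x,y) = dist(A,B)} is closed in X. -/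
open Metric Filter Topology

theorem isClosed_A0_of_approxCompact
    {X : Type*} [MetricSpace X]
    (A B : Set X) (hA : A.Nonempty) (hB : B.Nonempty)
    (hAcl : IsClosed A) (hBcl : IsClosed B)
    (hcomp : ApproxCompactWRT A B) :
    IsClosed (SetA0 A B) := by
  refine IsSeqClosed.isClosed fun u x hu hux => ?_
  have hxA : x ∈ A := hAcl.mem_of_tendsto hux (.of_forall fun n => (hu n).1)
  choose y hyB hy using fun n => (hu n).2
  have hlim : Tendsto (fun n => dist x (y n)) atTop (𝓝 (SetDist A B)) := by
    have hxu : Tendsto (fun n => dist x (u n) + SetDist A B) atTop (𝓝 (SetDist A B)) := by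
      simpa using ((tendsto_const_nhds (x := x)).dist hux).add_const (SetDist A B)
    exact tendsto_of_tendsto_of_tendsto_of_le_of_le tendsto_const_nhds hxu
      (fun n => setDist_le_dist hxA (hyB n)) fun n => hy n ▸ dist_triangle x (u n) (y n)
  have hinf : infDist x B = SetDist A B :=
    le_antisymm (ge_of_tendsto' hlim fun n => infDist_le_dist_of_mem (hyB n))
      ((le_infDist hB).2 fun _ hb => setDist_le_dist hxA hb)
  obtain ⟨φ, hφ, l, hl⟩ := hcomp y hyB ⟨x, hxA, hinf ▸ hlim⟩
  exact ⟨hxA, l, hBcl.mem_of_tendsto hl (.of_forall fun n => hyB (φ n)),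
    tendsto_nhds_unique (tendsto_const_nhds.dist hl) (hlim.comp hφ.tendsto_atTop)⟩
end

section
/- Let (M,d) be a complete metric space and T : M → M a p-contraction, i.e., there exists k ∈ (0,1) such that d(T x, T y) ≤ k (d(x,y) + |d(x, T x) − d(y, T y)|) for all x, y ∈ M. Then T has a unique fixed point, and for every x₀ ∈ M the Picard iteration sequence {Tⁿ(x₀)} converges to this fixed point. -/
open Filter Topology

theorem dist_map_map_le_of_pContraction {M : Type*} [PseudoMetricSpace M]
    {T : M → M} {k : ℝ} (hk0 : 0 < k) (hk : k < 1)
    (hT : ∀ x y : M, dist (T x) (T y) ≤ k * (dist x y + |dist x (T x) - dist y (T y)|)) (x : M) :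
    dist (T x) (T (T x)) ≤ 2 * k / (1 + k) * dist x (T x) := by
  have h := hT x (T x)
  have h0 : 0 ≤ dist x (T x) := dist_nonneg
  rw [div_mul_eq_mul_div, le_div_iff₀ (by linarith)]
  rcases abs_cases (dist x (T x) - dist (T x) (T (T x))) with ⟨h1, _⟩ | ⟨h1, _⟩ <;>
    rw [h1] at h <;> nlinarith

theorem cauchySeq_iterate_of_pContraction {M : Type*} [PseudoMetricSpace M]
    {T : M → M} {k : ℝ} (hk0 : 0 < k) (hk : k < 1)
    (hT : ∀ x y : M, dist (T x) (T y) ≤ k * (dist x y + |dist x (T x) - dist y (T y)|)) (x : M) :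
    CauchySeq (fun n => T^[n] x) := by
  refine cauchySeq_of_le_geometric (2 * k / (1 + k)) (dist x (T x))
    ((div_lt_one (by linarith)).2 (by linarith)) fun n => ?_
  induction n with
  | zero => simp
  | succ n ih =>
    have h := dist_map_map_le_of_pContraction hk0 hk hT (T^[n] x)
    simp only [Function.iterate_succ_apply'] at ih ⊢
    calc _ ≤ _ := h
      _ ≤ 2 * k / (1 + k) * (dist x (T x) * (2 * k / (1 + k)) ^ n) := by gcongr
      _ = _ := by ring

theorem isFixedPt_of_tendsto_iterate_of_pContraction {M : Type*} [MetricSpace M]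
    {T : M → M} {k : ℝ} (hk : k < 1)
    (hT : ∀ x y : M, dist (T x) (T y) ≤ k * (dist x y + |dist x (T x) - dist y (T y)|)) {x z : M}
    (hz : Tendsto (fun n => T^[n] x) atTop (𝓝 z)) : T z = z := by
  have hz' : Tendsto (fun n => T (T^[n] x)) atTop (𝓝 z) := by
    simpa only [Function.iterate_succ_apply'] using (tendsto_add_atTop_iff_nat 1).2 hz
  have h := le_of_tendsto_of_tendsto' (hz'.dist tendsto_const_nhds)
    (((hz.dist tendsto_const_nhds).add ((hz.dist hz').sub tendsto_const_nhds).abs).const_mul k)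
    fun n => hT (T^[n] x) z
  rw [dist_self, zero_sub, zero_add, abs_neg, abs_of_nonneg dist_nonneg] at h
  have h0 : 0 ≤ dist z (T z) := dist_nonneg
  exact (dist_le_zero.1 (by nlinarith)).symm

theorem eq_of_isFixedPt_of_pContraction {M : Type*} [MetricSpace M]
    {T : M → M} {k : ℝ} (hk : k < 1)
    (hT : ∀ x y : M, dist (T x) (T y) ≤ k * (dist x y + |dist x (T x) - dist y (T y)|)) {w z : M}
    (hw : T w = w) (hz : T z = z) : w = z := by
  have h := hT w z
  simp only [hw, hz, dist_self, sub_self, abs_zero, add_zero] at h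
  have h0 : 0 ≤ dist w z := dist_nonneg
  exact dist_le_zero.1 (by nlinarith)

theorem fixed_point_of_pContraction
    {M : Type*} [MetricSpace M] [CompleteSpace M] [Nonempty M]
    (T : M → M) (k : ℝ) (hk0 : 0 < k) (hk : k < 1)
    (hT : ∀ x y : M, dist (T x) (T y) ≤ k * (dist x y + |dist x (T x) - dist y (T y)|)) :
    ∃ z : M, T z = z ∧ (∀ w : M, T w = w → w = z) ∧
      ∀ x₀ : M, Tendsto (fun n => T^[n] x₀) atTop (𝓝 z) := by
  have hlim (x : M) : ∃ z, T z = z ∧ Tendsto (fun n => T^[n] x) atTop (𝓝 z) := by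
    obtain ⟨z, hz⟩ := cauchySeq_tendsto_of_complete (cauchySeq_iterate_of_pContraction hk0 hk hT x)
    exact ⟨z, isFixedPt_of_tendsto_iterate_of_pContraction hk hT hz, hz⟩
  obtain ⟨z, hz, -⟩ := hlim (Classical.arbitrary M)
  refine ⟨z, hz, fun w hw => eq_of_isFixedPt_of_pContraction hk hT hw hz, fun x₀ => ?_⟩
  obtain ⟨w, hw, hlimw⟩ := hlim x₀
  rwa [eq_of_isFixedPt_of_pContraction hk hT hw hz] at hlimw
end

section
/- Let (M,d) be a metric space, A, B nonempty subsets of M, and T : A → B a p-proximal contraction with constant k ∈ (0,1). If u₁, u₂, x₁, x₂ ∈ A satisfy d(u₁, T x₁) = dist(A,B) and d(u₂, T x₂) = dist(A,B), then d(u₁,u₂) ≤ (2k/(1−k)) · d(x₁,x₂). -/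
open Metric Filter Topology

theorem pProximal_two_k_bound
    {M : Type*} [MetricSpace M]
    (A B : Set M) (hA : A.Nonempty) (hB : B.Nonempty)
    (T : M → M) (k : ℝ) (hk0 : 0 < k) (hk : k < 1)
    (hT : IsPProximalContraction A B T k)
    (u₁ u₂ x₁ x₂ : M) (hu₁ : u₁ ∈ A) (hu₂ : u₂ ∈ A) (hx₁ : x₁ ∈ A) (hx₂ : x₂ ∈ A)
    (h1 : dist u₁ (T x₁) = SetDist A B) (h2 : dist u₂ (T x₂) = SetDist A B) :
    dist u₁ u₂ ≤ (2 * k / (1 - k)) * dist x₁ x₂ := by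
  have h := hT.2 u₁ hu₁ u₂ hu₂ x₁ hx₁ x₂ hx₂ h1 h2
  have habs : |dist u₁ x₁ - dist u₂ x₂| ≤ dist u₁ u₂ + dist x₁ x₂ :=
    dist_dist_dist_le u₁ x₁ u₂ x₂
  have hk' : 0 < 1 - k := sub_pos.mpr hk
  rw [div_mul_eq_mul_div, le_div_iff₀ hk']
  linarith [mul_le_mul_of_nonneg_left habs hk0.le]
end

section
/- Let (M,d) be a metric space, A, B nonempty subsets of M, and T : A → B a p-proximal contraction with constant k ∈ (0,1). If z₁, z₂ ∈ A are best proximity points of T, i.e., d(z₁, T z₁) = dist(A,B) and d(z₂, T z₂) = dist(A,B), then z₁ = z₂. -/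
open Metric Filter Topology

theorem pProximal_best_proximity_point_unique
    {M : Type*} [MetricSpace M]
    (A B : Set M) (hA : A.Nonempty) (hB : B.Nonempty)
    (T : M → M) (k : ℝ) (hk0 : 0 < k) (hk : k < 1)
    (hT : IsPProximalContraction A B T k)
    (z₁ z₂ : M) (hz₁ : z₁ ∈ A) (hz₂ : z₂ ∈ A)
    (h1 : dist z₁ (T z₁) = SetDist A B) (h2 : dist z₂ (T z₂) = SetDist A B) :
    z₁ = z₂ := by
  have h := hT.2 z₁ hz₁ z₂ hz₂ z₁ hz₁ z₂ hz₂ h1 h2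
  simp only [dist_self, sub_self, abs_zero, add_zero] at h
  have h_nonneg : 0 ≤ dist z₁ z₂ := dist_nonneg
  exact dist_le_zero.mp (by nlinarith)
end
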